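/- For every t ∈ ℝ and every b ∈ ℝ, one has Γ₂(t)(b·i) ≠ 0 and Γ₂(t)(1 + b·i) ≠ 0; that is, the polynomials Γ₂(t) have no root on the lines Re(z) = 0 and Re(z) = 1. -/

import Mathlib

open Polynomial

/-- The quartic `Γ₂(t)(X) = X⁴ − (16/3)X³ + (8 − 2e^{2πit})X² − 1/3`. -/
noncomputable def Gamma2 (t : ℝ) : Polynomial ℂ :=
  X ^ 4 - C (16 / 3 : ℂ) * X ^ 3
    + C ((8 : ℂ) - 2 * Complex.exp (2 * Real.pi * Complex.I * t)) * X ^ 2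
    - C (1 / 3 : ℂ)

/-- At a root `z` of `Γ₂(t)`, the `t`-independent part has squared modulus `4|z|⁴`. -/
theorem normSq_eq_of_eval_Gamma2_eq_zero {t : ℝ} {z : ℂ} (h : (Gamma2 t).eval z = 0) :
    Complex.normSq (z ^ 4 - 16 / 3 * z ^ 3 + 8 * z ^ 2 - 1 / 3) = 4 * Complex.normSq z ^ 2 := by
  have hexp : Complex.normSq (Complex.exp (2 * Real.pi * Complex.I * t)) = 1 := by
    rw [Complex.normSq_eq_norm_sq, show (2 * Real.pi * Complex.I * t : ℂ)
      = ((2 * Real.pi * t : ℝ) : ℂ) * Complex.I by push_cast; ring,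
      Complex.norm_exp_ofReal_mul_I, one_pow]
  have hz : z ^ 4 - 16 / 3 * z ^ 3 + 8 * z ^ 2 - 1 / 3
      = ((2 : ℝ) : ℂ) * Complex.exp (2 * Real.pi * Complex.I * t) * z ^ 2 := by
    simp only [Gamma2, eval_add, eval_sub, eval_mul, eval_pow, eval_X, eval_C] at h
    push_cast
    linear_combination h
  rw [hz, map_mul, map_mul, map_pow, hexp, Complex.normSq_ofReal]
  ring

/-- for all real `t` and `b`, the polynomial `Γ₂(t)` does not
vanish at `b·i` nor at `1 + b·i`; i.e. `Γ₂(t)` has no root on the lines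
`Re z = 0` and `Re z = 1`. -/
theorem stmt_17 (t b : ℝ) :
    (Gamma2 t).eval ((b : ℂ) * Complex.I) ≠ 0 ∧
      (Gamma2 t).eval (1 + (b : ℂ) * Complex.I) ≠ 0 := by
  have hI3 : Complex.I ^ 3 = -Complex.I := Complex.I_pow_three
  have hI4 : Complex.I ^ 4 = 1 := Complex.I_pow_four
  constructor <;> intro h <;> have h := normSq_eq_of_eval_Gamma2_eq_zero h
  · rw [show ((b : ℂ) * Complex.I) ^ 4 - 16 / 3 * ((b : ℂ) * Complex.I) ^ 3
        + 8 * ((b : ℂ) * Complex.I) ^ 2 - 1 / 3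
        = ((b ^ 4 - 8 * b ^ 2 - 1 / 3 : ℝ) : ℂ) + ((16 / 3 * b ^ 3 : ℝ) : ℂ) * Complex.I by
          simp only [mul_pow, hI3, hI4, Complex.I_sq]; push_cast; ring,
      Complex.normSq_add_mul_I, map_mul, Complex.normSq_ofReal, Complex.normSq_I] at h
    have hpos : 0 < b ^ 8 + 112 / 9 * b ^ 6 + 178 / 3 * b ^ 4 + 16 / 3 * b ^ 2 + 1 / 9 := by
      positivity
    linarith
  · have hone : (1 + (b : ℂ) * Complex.I) = ((1 : ℝ) : ℂ) + (b : ℂ) * Complex.I := by simp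
    rw [show (1 + (b : ℂ) * Complex.I) ^ 4 - 16 / 3 * (1 + (b : ℂ) * Complex.I) ^ 3
        + 8 * (1 + (b : ℂ) * Complex.I) ^ 2 - 1 / 3
        = ((b ^ 4 + 2 * b ^ 2 + 10 / 3 : ℝ) : ℂ)
          + ((b * (4 + 4 / 3 * b ^ 2) : ℝ) : ℂ) * Complex.I by
          ring_nf; simp only [hI3, hI4, Complex.I_sq]; push_cast; ring,
      hone, Complex.normSq_add_mul_I, Complex.normSq_add_mul_I] at h
    have hpos : 0 < (b ^ 4 + 4 / 3) * (b ^ 4 + 4 * b ^ 2 + 16 / 3)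
        + (b * (4 + 4 / 3 * b ^ 2)) ^ 2 := by
      positivity
    linarith
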